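/- Let A be an irredundant, density regular ℓ×k integer matrix of rank ℓ, and for each n let H_n be the k-uniform hypergraph with vertex set [n] whose edges are the sets {x₁,…,x_k} for distinct-valued solutions (x₁,…,x_k) of Ax = 0 with all x_j ∈ [n]. Then for every i ∈ [k−1] there are constants K and n₀ such that for every n ≥ n₀ and every q ≥ n^{-1/m(A)} we have μ_i(H_n, q) ≤ K·q^{2i}·|E(H_n)|²/n. In particular, (H_n) is (K, (n^{-1/m(A)})_{n∈ℕ})-bounded. -/

import Mathlib

open Finset Filter

/-- The probability weight of obtaining exactly the subset `S` when each element of the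
finite ground set `Γ` is included independently with probability `p`. -/
noncomputable def binomWeight {α : Type*} (Γ : Finset α) (p : ℝ) (S : Finset α) : ℝ :=
  p ^ S.card * (1 - p) ^ (Γ.card - S.card)

open Classical in
/-- The probability that the binomial random subset `Γ_p` satisfies the property `P`. -/
noncomputable def binomProb {α : Type*} (Γ : Finset α) (p : ℝ) (P : Finset α → Prop) : ℝ :=
  ∑ S ∈ Γ.powerset, if P S then binomWeight Γ p S else 0

/-- `deg_i(v, U)`: the number of edges `e` of the hypergraph with edge set `E` such that
`v ∈ e` and `|e ∩ (U \ {v})| ≥ i`. -/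
def degi {α : Type*} [DecidableEq α] (E : Finset (Finset α)) (i : ℕ) (v : α) (U : Finset α) : ℕ :=
  (E.filter fun e => v ∈ e ∧ i ≤ (e ∩ U.erase v).card).card

/-- `μ_i(H, q)`: the expected value of `∑_{v ∈ V} deg_i(v, V_q)²` for the binomial random
subset `V_q` of the vertex set `V` of the hypergraph `H = (V, E)`. -/
noncomputable def mu {α : Type*} [DecidableEq α] (V : Finset α) (E : Finset (Finset α))
    (i : ℕ) (q : ℝ) : ℝ :=
  ∑ S ∈ V.powerset, binomWeight V q S * ∑ v ∈ V, (degi E i v S : ℝ) ^ 2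

/-- A sequence of hypergraphs `(V n, E n)` is `α`-dense. -/
def AlphaDense {α : Type*} [DecidableEq α] (V : ℕ → Finset α) (E : ℕ → Finset (Finset α))
    (a : ℝ) : Prop :=
  ∀ ε : ℝ, 0 < ε → ∃ ζ : ℝ, 0 < ζ ∧ ∃ n₀ : ℕ, ∀ n ≥ n₀, ∀ U ⊆ V n,
    (a + ε) * ((V n).card : ℝ) ≤ (U.card : ℝ) →
    ζ * ((E n).card : ℝ) ≤ (((E n).filter fun e => e ⊆ U).card : ℝ)

/-- A sequence of `k`-uniform hypergraphs `(V n, E n)` is `(K, p)`-bounded. -/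
def KPBounded {α : Type*} [DecidableEq α] (k : ℕ) (V : ℕ → Finset α)
    (E : ℕ → Finset (Finset α)) (K : ℝ) (p : ℕ → ℝ) : Prop :=
  ∀ i : ℕ, 1 ≤ i → i ≤ k - 1 → ∃ n₀ : ℕ, ∀ n ≥ n₀, ∀ q : ℝ, p n ≤ q → q ≤ 1 →
    mu (V n) (E n) i q ≤ K * q ^ (2 * i) * ((E n).card : ℝ) ^ 2 / ((V n).card : ℝ)

/-- The rank of an integer matrix, computed over `ℝ`. -/
noncomputable def rankR {l k : ℕ} (A : Matrix (Fin l) (Fin k) ℤ) : ℕ :=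
  (A.map (fun a => (a : ℝ))).rank

/-- The rank (over `ℝ`) of the submatrix of `A` given by the columns indexed by `T`. -/
noncomputable def rankCols {l k : ℕ} (A : Matrix (Fin l) (Fin k) ℤ) (T : Finset (Fin k)) : ℕ :=
  ((A.map (fun a => (a : ℝ))).submatrix id (fun j : {x : Fin k // x ∈ T} => j.val)).rank

/-- The parameter `m(A)`. -/
noncomputable def mOfMatrix {l k : ℕ} (A : Matrix (Fin l) (Fin k) ℤ) : ℝ :=
  sSup { r : ℝ | ∃ W : Finset (Fin k), 2 ≤ W.card ∧
    r = ((W.card : ℝ) - 1) / (((W.card : ℝ) - 1) + (rankCols A Wᶜ : ℝ) - (rankR A : ℝ)) }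

/-- `A` is irredundant: `Ax = 0` has a solution with pairwise distinct coordinates. -/
def Irredundant {l k : ℕ} (A : Matrix (Fin l) (Fin k) ℤ) : Prop :=
  ∃ x : Fin k → ℝ, (A.map (fun a => (a : ℝ))).mulVec x = 0 ∧ Function.Injective x

/-- `Y` contains a distinct-valued solution of the system `Ax = 0`. -/
def HasDistinctSol {l k : ℕ} (A : Matrix (Fin l) (Fin k) ℤ) (Y : Finset ℕ) : Prop :=
  ∃ x : Fin k → ℕ, (∀ j, x j ∈ Y) ∧ Function.Injective x ∧
    A.mulVec (fun j => (x j : ℤ)) = 0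

/-- `A` is density regular. -/
def DensityRegular {l k : ℕ} (A : Matrix (Fin l) (Fin k) ℤ) : Prop :=
  ∀ ε : ℝ, 0 < ε → ∃ n₀ : ℕ, ∀ n ≥ n₀, ∀ Y ⊆ Finset.Icc 1 n,
    ε * (n : ℝ) ≤ (Y.card : ℝ) → HasDistinctSol A Y

open Classical in
/-- The edge set of the hypergraph `H_n`: the sets `{x₁, …, x_k}` for distinct-valued
solutions of `Ax = 0` with all coordinates in `[n]`. -/
noncomputable def solEdges {l k : ℕ} (A : Matrix (Fin l) (Fin k) ℤ) (n : ℕ) :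
    Finset (Finset ℕ) :=
  (Finset.Icc 1 n).powerset.filter fun e => ∃ x : Fin k → ℕ,
    Function.Injective x ∧ Finset.univ.image x = e ∧ A.mulVec (fun j => (x j : ℤ)) = 0

theorem DensityRegular.mulVec_one_eq_zero {l k : ℕ} {A : Matrix (Fin l) (Fin k) ℤ}
    (h : DensityRegular A) : A.mulVec 1 = 0 := by
  ext r
  set M : ℕ := (A.mulVec 1 r).natAbs + 1 with hM
  have hM0 : (0 : ℝ) < M := by positivity
  obtain ⟨n₀, hn₀⟩ := h (1 / M) (by positivity)
  obtain ⟨x, hx, -, hAx⟩ := hn₀ (M * n₀) (Nat.le_mul_of_pos_left _ (by positivity))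
    ((Finset.range n₀).image fun s => M * s + 1) (by
      intro y hy
      obtain ⟨s, hs, rfl⟩ := Finset.mem_image.1 hy
      have hs' : s + 1 ≤ n₀ := Finset.mem_range.1 hs
      have : M * (s + 1) ≤ M * n₀ := Nat.mul_le_mul_left _ hs'
      have : 1 ≤ M := by omega
      rw [Finset.mem_Icc]
      constructor
      · omega
      · linarith) (by
      rw [Finset.card_image_of_injective, Finset.card_range]
      · push_cast
        field_simp
        exact le_rfl
      · intro a b hab
        have hab' : M * a + 1 = M * b + 1 := hab
        exact Nat.eq_of_mul_eq_mul_left (by omega : 0 < M) (by omega))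
  choose s _ hs using fun j => Finset.mem_image.1 (hx j)
  have hsum : (M : ℤ) * A.mulVec (fun j => (s j : ℤ)) r + A.mulVec 1 r = 0 := by
    have := congrFun hAx r
    simp only [Matrix.mulVec, dotProduct, ← hs, Pi.zero_apply, Pi.one_apply] at this ⊢
    rw [← this, Finset.mul_sum, ← Finset.sum_add_distrib]
    refine Finset.sum_congr rfl fun j _ => ?_
    push_cast
    ring
  have hdvd : (M : ℤ) ∣ A.mulVec 1 r :=
    ⟨-A.mulVec (fun j => (s j : ℤ)) r, by linarith⟩
  refine Int.eq_zero_of_abs_lt_dvd hdvd ?_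
  rw [Int.abs_eq_natAbs, hM]
  push_cast
  omega

/-- The distinct-valued solutions of `Ax = 0` with all coordinates in `[n]`. -/
def solTuples {l k : ℕ} (A : Matrix (Fin l) (Fin k) ℤ) (n : ℕ) : Finset (Fin k → ℕ) :=
  (Fintype.piFinset fun _ => Finset.Icc 1 n).filter fun x =>
    Function.Injective x ∧ A.mulVec (fun j => (x j : ℤ)) = 0

theorem mem_solTuples {l k : ℕ} {A : Matrix (Fin l) (Fin k) ℤ} {n : ℕ} {x : Fin k → ℕ} :
    x ∈ solTuples A n ↔ (∀ j, 1 ≤ x j ∧ x j ≤ n) ∧ Function.Injective x ∧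
      A.mulVec (fun j => (x j : ℤ)) = 0 := by
  simp [solTuples]

theorem mem_solEdges {l k : ℕ} {A : Matrix (Fin l) (Fin k) ℤ} {n : ℕ} {e : Finset ℕ} :
    e ∈ solEdges A n ↔ ∃ x ∈ solTuples A n, Finset.univ.image x = e := by
  simp only [solEdges, Finset.mem_filter, Finset.mem_powerset, mem_solTuples]
  constructor
  · rintro ⟨he, x, hx, rfl, hA⟩
    refine ⟨x, ⟨fun j => ?_, hx, hA⟩, rfl⟩
    simpa using he (Finset.mem_image_of_mem x (Finset.mem_univ j))
  · rintro ⟨x, ⟨hn, hx, hA⟩, rfl⟩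
    refine ⟨fun y hy => ?_, x, hx, rfl, hA⟩
    obtain ⟨j, -, rfl⟩ := Finset.mem_image.1 hy
    simpa using hn j

theorem card_solTuples_le {l k : ℕ} (A : Matrix (Fin l) (Fin k) ℤ) (n : ℕ) :
    (solTuples A n).card ≤ k ^ k * (solEdges A n).card := by
  classical
  have himage : (solTuples A n).image (fun x => Finset.univ.image x) = solEdges A n := by
    ext e
    simp [mem_solEdges]
  rw [← himage]
  refine Finset.card_le_mul_card_image _ _ fun e he => ?_
  obtain ⟨x, -, rfl⟩ := Finset.mem_image.1 he
  calc _ ≤ (Fintype.piFinset fun _ : Fin k => Finset.univ.image x).card := by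
        refine Finset.card_le_card fun y hy => ?_
        rw [Fintype.mem_piFinset]
        intro j
        rw [← (Finset.mem_filter.1 hy).2]
        exact Finset.mem_image_of_mem y (Finset.mem_univ j)
    _ ≤ k ^ k := by
        rw [Fintype.card_piFinset_const]
        refine (Nat.pow_le_pow_left Finset.card_image_le _).trans ?_
        simp

theorem abs_mulVec_le {l k : ℕ} (A : Matrix (Fin l) (Fin k) ℤ) {y : Fin k → ℕ} {M : ℕ}
    (hy : ∀ j, y j ≤ M) (r : Fin l) :
    |A.mulVec (fun j => (y j : ℤ)) r| ≤ (((∑ r, ∑ j, (A r j).natAbs) * M : ℕ) : ℤ) := by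
  have hrow : ∑ j, (A r j).natAbs ≤ ∑ r, ∑ j, (A r j).natAbs :=
    Finset.single_le_sum (f := fun r => ∑ j, (A r j).natAbs) (fun _ _ => Nat.zero_le _)
      (Finset.mem_univ r)
  simp only [Matrix.mulVec, dotProduct]
  calc |∑ j, A r j * (y j : ℤ)| ≤ ∑ j, |A r j * (y j : ℤ)| :=
        Finset.abs_sum_le_sum_abs _ _
    _ ≤ ∑ j, ((A r j).natAbs : ℤ) * M := by
        refine Finset.sum_le_sum fun j _ => ?_
        rw [abs_mul, Int.abs_eq_natAbs, Nat.abs_cast]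
        exact mul_le_mul_of_nonneg_left (Nat.cast_le.2 (hy j)) (Int.natCast_nonneg _)
    _ = ((∑ j, (A r j).natAbs : ℕ) : ℤ) * M := by
        rw [← Finset.sum_mul, Nat.cast_sum]
    _ ≤ ((∑ r, ∑ j, (A r j).natAbs : ℕ) : ℤ) * M :=
        mul_le_mul_of_nonneg_right (Nat.cast_le.2 hrow) (Int.natCast_nonneg M)
    _ = _ := (Nat.cast_mul _ _).symm

theorem pow_le_card_solTuples_mul {l k : ℕ} (A : Matrix (Fin l) (Fin k) ℤ) {n₁ : ℕ}
    {x : Fin k → ℕ} (hx : x ∈ solTuples A n₁) {M n : ℕ} (hn : M * (2 * n₁ + 1) ≤ n) :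
    M ^ k ≤ (solTuples A n).card * (2 * ((∑ r, ∑ j, (A r j).natAbs) * M) + 1) ^ l := by
  classical
  set B := ∑ r, ∑ j, (A r j).natAbs with hB
  obtain ⟨hxn, hxinj, hAx⟩ := mem_solTuples.1 hx
  set Y : Finset (Fin k → ℕ) := Fintype.piFinset fun _ => Finset.range M with hY
  set f : (Fin k → ℕ) → Fin l → ℤ := fun y => A.mulVec fun j => (y j : ℤ) with hf
  have hcardY : Y.card = M ^ k := by simp [hY]
  have himage : (Y.image f).card ≤ (2 * (B * M) + 1) ^ l := by
    calc (Y.image f).card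
        ≤ (Fintype.piFinset fun _ : Fin l => Finset.Icc (-((B * M : ℕ) : ℤ)) (B * M : ℕ)).card := by
          refine Finset.card_le_card fun z hz => ?_
          obtain ⟨y, hy, rfl⟩ := Finset.mem_image.1 hz
          rw [Fintype.mem_piFinset]
          intro r
          rw [Finset.mem_Icc, ← abs_le]
          exact abs_mulVec_le A
            (fun j => (Finset.mem_range.1 (Fintype.mem_piFinset.1 hy j)).le) r
      _ = (2 * (B * M) + 1) ^ l := by
          rw [Fintype.card_piFinset_const, Int.card_Icc]
          congr 1
          omega
  rw [← hcardY]
  refine (Finset.card_le_mul_card_image Y (solTuples A n).card fun b hb => ?_).trans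
    (Nat.mul_le_mul_left _ himage)
  obtain ⟨y₀, hy₀, rfl⟩ := Finset.mem_image.1 hb
  have hlt : ∀ y ∈ Y, ∀ j, y j < M := fun y hy j =>
    Finset.mem_range.1 (Fintype.mem_piFinset.1 hy j)
  have hle : ∀ j, 2 * M ≤ 2 * M * x j := fun j => Nat.le_mul_of_pos_right _ (hxn j).1
  refine Finset.card_le_card_of_injOn (fun y j => 2 * M * x j + y j - y₀ j) ?_ ?_
  · intro y hy
    obtain ⟨hyY, hfy⟩ := Finset.mem_filter.1 hy
    refine mem_solTuples.2 ⟨fun j => ?_, fun a b hab => ?_, ?_⟩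
    · have h1 := hlt y hyY j
      have h2 := hlt y₀ hy₀ j
      have h3 := hle j
      have h4 : 2 * M * x j ≤ 2 * M * n₁ := Nat.mul_le_mul_left _ (hxn j).2
      have h5 : M * (2 * n₁ + 1) = 2 * M * n₁ + M := by ring
      show 1 ≤ 2 * M * x j + y j - y₀ j ∧ 2 * M * x j + y j - y₀ j ≤ n
      omega
    · apply hxinj
      have hab' : 2 * M * x a + y a - y₀ a = 2 * M * x b + y b - y₀ b := hab
      have a1 := hlt y hyY a
      have a2 := hlt y₀ hy₀ a
      have a3 := hle a
      have b1 := hlt y hyY b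
      have b2 := hlt y₀ hy₀ b
      have b3 := hle b
      rcases lt_trichotomy (x a) (x b) with h | h | h
      · have h4 : 2 * M * (x a + 1) ≤ 2 * M * x b := Nat.mul_le_mul_left _ h
        rw [mul_add] at h4
        omega
      · exact h
      · have h4 : 2 * M * (x b + 1) ≤ 2 * M * x a := Nat.mul_le_mul_left _ h
        rw [mul_add] at h4
        omega
    · have hcast : (fun j => ((2 * M * x j + y j - y₀ j : ℕ) : ℤ)) =
          (2 * M : ℤ) • (fun j => (x j : ℤ)) + (fun j => (y j : ℤ)) - fun j => (y₀ j : ℤ) := by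
        ext j
        have h2 := hlt y₀ hy₀ j
        have h3 := hle j
        rw [Nat.cast_sub (by omega)]
        simp
      have hfy' : A.mulVec (fun j => (y j : ℤ)) = A.mulVec fun j => (y₀ j : ℤ) := hfy
      rw [hcast, Matrix.mulVec_sub, Matrix.mulVec_add, Matrix.mulVec_smul, hAx, hfy']
      simp
  · intro y hy z hz hyz
    ext j
    have h := congrFun hyz j
    have h1 := hlt y₀ hy₀ j
    have h2 := hle j
    simp only at h
    omega

theorem exists_le_card_solEdges {l k : ℕ} {A : Matrix (Fin l) (Fin k) ℤ}
    (hdr : DensityRegular A) (hlk : l ≤ k) :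
    ∃ c : ℝ, 0 < c ∧ ∃ n₀ : ℕ, ∀ n ≥ n₀, c * (n : ℝ) ^ (k - l) ≤ ((solEdges A n).card : ℝ) := by
  obtain ⟨n₁, hn₁⟩ := hdr 1 one_pos
  obtain ⟨x, hxY, hxinj, hAx⟩ := hn₁ n₁ le_rfl (Finset.Icc 1 n₁) subset_rfl (by simp)
  have hx : x ∈ solTuples A n₁ :=
    mem_solTuples.2 ⟨fun j => Finset.mem_Icc.1 (hxY j), hxinj, hAx⟩
  set B := ∑ r, ∑ j, (A r j).natAbs with hB
  set N := 2 * n₁ + 1 with hN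
  have hkk : (0 : ℝ) < (k : ℝ) ^ k := by
    exact_mod_cast (Nat.pow_self_pos : 0 < k ^ k)
  refine ⟨((k : ℝ) ^ k * (2 * B + 1) ^ l * (2 * N) ^ (k - l))⁻¹, by positivity, N, fun n hn => ?_⟩
  have hNpos : 0 < N := by omega
  set M := n / N with hM
  have hM1 : 1 ≤ M := (Nat.one_le_div_iff hNpos).2 hn
  have hMn : M * N ≤ n := Nat.div_mul_le_self n N
  have hnM : n ≤ 2 * N * M := by
    have h1 : n < N * (M + 1) := Nat.lt_mul_div_succ n hNpos
    nlinarith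
  have key := pow_le_card_solTuples_mul A hx hMn
  have h2 : M ^ (k - l) * M ^ l ≤ (k ^ k * (solEdges A n).card * (2 * B + 1) ^ l) * M ^ l := by
    rw [← pow_add, Nat.sub_add_cancel hlk]
    refine key.trans ?_
    calc _ ≤ (k ^ k * (solEdges A n).card) * ((2 * B + 1) * M) ^ l := by
          refine Nat.mul_le_mul (card_solTuples_le A n) (Nat.pow_le_pow_left ?_ l)
          rw [← hB]
          nlinarith
      _ = _ := by rw [mul_pow]; ring
  have h3 : M ^ (k - l) ≤ k ^ k * (solEdges A n).card * (2 * B + 1) ^ l :=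
    Nat.le_of_mul_le_mul_right h2 (by positivity)
  have h4 : n ^ (k - l) ≤
      (k ^ k * (2 * B + 1) ^ l * (2 * N) ^ (k - l)) * (solEdges A n).card := by
    calc n ^ (k - l) ≤ (2 * N * M) ^ (k - l) := Nat.pow_le_pow_left hnM _
      _ = (2 * N) ^ (k - l) * M ^ (k - l) := mul_pow _ _ _
      _ ≤ (2 * N) ^ (k - l) * (k ^ k * (solEdges A n).card * (2 * B + 1) ^ l) :=
          Nat.mul_le_mul_left _ h3
      _ = _ := by ring
  rw [inv_mul_le_iff₀ (by positivity)]
  exact_mod_cast h4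

/-- The `j`-th column of the integer matrix `A`, as a real vector. -/
def realCol {l k : ℕ} (A : Matrix (Fin l) (Fin k) ℤ) (j : Fin k) : Fin l → ℝ :=
  fun r => (A r j : ℝ)

theorem rankR_eq_finrank {l k : ℕ} (A : Matrix (Fin l) (Fin k) ℤ) :
    rankR A = Module.finrank ℝ (Submodule.span ℝ (Set.range (realCol A))) := by
  rw [rankR, Matrix.rank_eq_finrank_span_cols]
  rfl

theorem rankCols_eq_finrank {l k : ℕ} (A : Matrix (Fin l) (Fin k) ℤ) (T : Finset (Fin k)) :
    rankCols A T = Module.finrank ℝ (Submodule.span ℝ (realCol A '' (T : Set (Fin k)))) := by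
  rw [rankCols, Matrix.rank_eq_finrank_span_cols, Set.image_eq_range]
  rfl

theorem realCol_mem_span {l k : ℕ} {A : Matrix (Fin l) (Fin k) ℤ} {y : Fin k → ℝ}
    (hy : ∑ j, y j • realCol A j = 0) {S : Finset (Fin k)} {a : Fin k} (ha : y a ≠ 0)
    (hS : ∀ j ∈ S, j ≠ a → y j = 0) :
    realCol A a ∈ Submodule.span ℝ (realCol A '' ((Sᶜ : Finset (Fin k)) : Set (Fin k))) := by
  rw [← Finset.add_sum_erase _ _ (Finset.mem_univ a)] at hy
  rw [← Submodule.smul_mem_iff _ ha, eq_neg_of_add_eq_zero_left hy]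
  refine Submodule.neg_mem _ (Submodule.sum_mem _ fun j hj => ?_)
  by_cases hjS : j ∈ S
  · rw [hS j hjS (Finset.ne_of_mem_erase hj), zero_smul]
    exact Submodule.zero_mem _
  · exact Submodule.smul_mem _ _ (Submodule.subset_span ⟨j, by simpa using hjS, rfl⟩)

theorem rankR_le_of_realCol_mem_span {l k : ℕ} {A : Matrix (Fin l) (Fin k) ℤ}
    {S W : Finset (Fin k)} (hSW : S ⊆ W)
    (hS : ∀ a ∈ S,
      realCol A a ∈ Submodule.span ℝ (realCol A '' ((Sᶜ : Finset (Fin k)) : Set (Fin k)))) :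
    rankR A + S.card ≤ rankCols A Wᶜ + W.card := by
  classical
  set U := Submodule.span ℝ (realCol A '' ((Wᶜ : Finset (Fin k)) : Set (Fin k))) with hU
  set V := Submodule.span ℝ (((W \ S).image (realCol A) : Finset (Fin l → ℝ)) :
    Set (Fin l → ℝ)) with hV
  have hSc : Submodule.span ℝ (realCol A '' ((Sᶜ : Finset (Fin k)) : Set (Fin k))) ≤ U ⊔ V := by
    rw [Submodule.span_le]
    rintro _ ⟨j, hj, rfl⟩
    have hjS : j ∉ S := by simpa using hj
    by_cases hjW : j ∈ W
    · refine Submodule.mem_sup_right (Submodule.subset_span ?_)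
      exact Finset.mem_coe.2 (Finset.mem_image_of_mem _ (Finset.mem_sdiff.2 ⟨hjW, hjS⟩))
    · exact Submodule.mem_sup_left (Submodule.subset_span ⟨j, by simpa using hjW, rfl⟩)
  have hle : Submodule.span ℝ (Set.range (realCol A)) ≤ U ⊔ V := by
    rw [Submodule.span_le]
    rintro _ ⟨j, rfl⟩
    by_cases hj : j ∈ S
    · exact hSc (hS j hj)
    · exact hSc (Submodule.subset_span ⟨j, by simpa using hj, rfl⟩)
  have h1 : rankR A ≤ rankCols A Wᶜ + (W \ S).card := by
    rw [rankR_eq_finrank, rankCols_eq_finrank]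
    calc _ ≤ Module.finrank ℝ (U ⊔ V : Submodule ℝ (Fin l → ℝ)) := Submodule.finrank_mono hle
      _ ≤ Module.finrank ℝ U + Module.finrank ℝ V :=
          Submodule.finrank_add_le_finrank_add_finrank U V
      _ ≤ _ := Nat.add_le_add_left
          ((finrank_span_finset_le_card _).trans Finset.card_image_le) _
  have h2 := Finset.card_sdiff_add_card_eq_card hSW
  omega

theorem sum_realCol_eq_zero {l k : ℕ} {A : Matrix (Fin l) (Fin k) ℤ} (h : A.mulVec 1 = 0) :
    ∑ j, realCol A j = 0 := by
  ext r
  have := congrFun h r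
  simp only [Matrix.mulVec, dotProduct, Pi.one_apply, mul_one, Pi.zero_apply] at this
  simp only [Finset.sum_apply, realCol, Pi.zero_apply]
  exact_mod_cast this

theorem rankR_add_one_le {l k : ℕ} {A : Matrix (Fin l) (Fin k) ℤ} (h : A.mulVec 1 = 0)
    {W : Finset (Fin k)} (hW : W.Nonempty) : rankR A + 1 ≤ rankCols A Wᶜ + W.card := by
  obtain ⟨a, ha⟩ := hW
  have key := rankR_le_of_realCol_mem_span (A := A) (Finset.singleton_subset_iff.2 ha)
    (fun b hb => realCol_mem_span (y := 1) (by simpa using sum_realCol_eq_zero h) one_ne_zero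
      fun j hj hjb => absurd ((Finset.mem_singleton.1 hj).trans (Finset.mem_singleton.1 hb).symm) hjb)
  simpa using key

theorem rankR_add_two_le {l k : ℕ} {A : Matrix (Fin l) (Fin k) ℤ} (h : A.mulVec 1 = 0)
    (hirr : Irredundant A) {W : Finset (Fin k)} (hW : 2 ≤ W.card) :
    rankR A + 2 ≤ rankCols A Wᶜ + W.card := by
  obtain ⟨a, ha, b, hb, hab⟩ := Finset.one_lt_card.1 hW
  obtain ⟨x, hx, hxinj⟩ := hirr
  have hsum : ∀ c : Fin k, ∑ j, (x j - x c) • realCol A j = 0 := by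
    intro c
    simp only [sub_smul, Finset.sum_sub_distrib, ← Finset.smul_sum, sum_realCol_eq_zero h,
      smul_zero, sub_zero]
    ext r
    have := congrFun hx r
    simp only [Matrix.mulVec, dotProduct, Matrix.map_apply, Pi.zero_apply] at this
    simpa [Finset.sum_apply, realCol, mul_comm] using this
  have key := rankR_le_of_realCol_mem_span (A := A) (S := {a, b}) (W := W)
    (Finset.insert_subset ha (Finset.singleton_subset_iff.2 hb)) (by
      intro c hc
      rcases Finset.mem_insert.1 hc with rfl | hc
      · refine realCol_mem_span (hsum b) (sub_ne_zero.2 fun hh => hab (hxinj hh)) ?_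
        intro j hj hjc
        rcases Finset.mem_insert.1 hj with rfl | hj
        · exact absurd rfl hjc
        · rw [Finset.mem_singleton.1 hj, sub_self]
      · obtain rfl := Finset.mem_singleton.1 hc
        refine realCol_mem_span (hsum a) (sub_ne_zero.2 fun hh => hab (hxinj hh).symm) ?_
        intro j hj hjc
        rcases Finset.mem_insert.1 hj with rfl | hj
        · exact sub_self _
        · exact absurd (Finset.mem_singleton.1 hj) hjc)
  rwa [Finset.card_pair hab] at key

theorem exists_independent_columns {l k : ℕ} (A : Matrix (Fin l) (Fin k) ℤ)
    (T : Finset (Fin k)) :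
    ∃ B ⊆ T, B.card = rankCols A T ∧ LinearIndepOn ℝ (realCol A) (B : Set (Fin k)) := by
  classical
  obtain ⟨b, hbT, -, hspan, hli⟩ := exists_linearIndepOn_extension (K := ℝ) (v := realCol A)
    (linearIndepOn_empty ℝ _) (Set.empty_subset (T : Set (Fin k)))
  have hcoe : ((b.toFinset : Finset (Fin k)) : Set (Fin k)) = b := Set.coe_toFinset b
  refine ⟨b.toFinset, fun j hj => hbT (Set.mem_toFinset.1 hj), ?_, by rwa [hcoe]⟩
  have heq : Submodule.span ℝ (realCol A '' (T : Set (Fin k))) =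
      Submodule.span ℝ (Set.range fun j : b => realCol A j) := by
    rw [← Set.image_eq_range]
    exact le_antisymm (Submodule.span_le.2 hspan) (Submodule.span_mono (Set.image_mono hbT))
  rw [rankCols_eq_finrank, heq, finrank_span_eq_card hli, Set.toFinset_card]

theorem card_filter_solTuples_le {l k : ℕ} (A : Matrix (Fin l) (Fin k) ℤ) (n : ℕ)
    (W : Finset (Fin k)) (R : Finset ℕ) (hR : R.card ≤ k) :
    ((solTuples A n).filter fun x => ∀ j ∈ W, x j ∈ R).card ≤
      k ^ W.card * n ^ (Wᶜ.card - rankCols A Wᶜ) := by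
  classical
  obtain ⟨B, hBW, hBcard, hB⟩ := exists_independent_columns A Wᶜ
  set F : Fin k → Finset ℕ := fun j => if j ∈ W then R else if j ∈ B then {0} else Finset.Icc 1 n
    with hF
  have hdisj : ∀ j ∈ W, j ∉ B := fun j hj hjB => Finset.mem_compl.1 (hBW hjB) hj
  calc _ ≤ (Fintype.piFinset F).card := by
        refine Finset.card_le_card_of_injOn (fun x j => if j ∈ B then 0 else x j) ?_ ?_
        · intro x hx
          obtain ⟨hxs, hxW⟩ := Finset.mem_filter.1 hx
          refine Finset.mem_coe.2 (Fintype.mem_piFinset.2 fun j => ?_)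
          by_cases hjW : j ∈ W
          · simpa [hF, hjW, hdisj j hjW] using hxW j hjW
          · by_cases hjB : j ∈ B
            · simp [hF, hjW, hjB]
            · simpa [hF, hjW, hjB] using (mem_solTuples.1 hxs).1 j
        · intro x hx y hy hxy
          have hx0 := (mem_solTuples.1 (Finset.mem_filter.1 hx).1).2.2
          have hy0 := (mem_solTuples.1 (Finset.mem_filter.1 hy).1).2.2
          have hoff : ∀ j ∉ B, x j = y j := fun j hj => by
            have := congrFun hxy j
            simpa [hj] using this
          have hzero : ∑ j ∈ B, ((x j : ℝ) - y j) • realCol A j = 0 := by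
            rw [Finset.sum_subset (Finset.subset_univ B) fun j _ hj => by
              rw [hoff j hj, sub_self, zero_smul]]
            ext r
            have h1 := congrFun hx0 r
            have h2 := congrFun hy0 r
            simp only [Matrix.mulVec, dotProduct, Pi.zero_apply] at h1 h2
            have h3 : ∑ j, (A r j : ℝ) * (x j : ℝ) = 0 := by exact_mod_cast h1
            have h4 : ∑ j, (A r j : ℝ) * (y j : ℝ) = 0 := by exact_mod_cast h2
            simp only [Finset.sum_apply, Pi.smul_apply, realCol, smul_eq_mul, sub_mul,
              Finset.sum_sub_distrib, Pi.zero_apply]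
            simp only [mul_comm] at h3 h4 ⊢
            rw [h3, h4, sub_zero]
          ext j
          by_cases hj : j ∈ B
          · have := linearIndepOn_finset_iff.1 hB _ hzero j hj
            exact_mod_cast sub_eq_zero.1 this
          · exact hoff j hj
    _ = ∏ j, (F j).card := Fintype.card_piFinset F
    _ = (∏ j ∈ W, (F j).card) * ∏ j ∈ Wᶜ, (F j).card := (Finset.prod_mul_prod_compl _ _).symm
    _ = (∏ j ∈ W, (F j).card) * ((∏ j ∈ Wᶜ \ B, (F j).card) * ∏ j ∈ B, (F j).card) := by
        rw [Finset.prod_sdiff hBW]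
    _ = R.card ^ W.card * (n ^ (Wᶜ.card - rankCols A Wᶜ) * 1) := by
        congr 1
        · refine Finset.prod_eq_pow_card fun j hj => ?_
          simp [hF, hj]
        · congr 1
          · rw [← hBcard, ← Finset.card_sdiff_of_subset hBW]
            refine Finset.prod_eq_pow_card fun j hj => ?_
            obtain ⟨hjW, hjB⟩ := Finset.mem_sdiff.1 hj
            simp [hF, Finset.mem_compl.1 hjW, hjB]
          · refine Finset.prod_eq_one fun j hj => ?_
            have hjW : j ∉ W := fun h => hdisj j h hj
            simp [hF, hjW, hj]
    _ ≤ _ := by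
        rw [mul_one]
        exact Nat.mul_le_mul_right _ (Nat.pow_le_pow_left hR _)

theorem rankCols_le_card {l k : ℕ} (A : Matrix (Fin l) (Fin k) ℤ) (T : Finset (Fin k)) :
    rankCols A T ≤ T.card := by
  obtain ⟨B, hBT, hB, -⟩ := exists_independent_columns A T
  exact hB ▸ Finset.card_le_card hBT

theorem card_solTuples_le_pow {l k : ℕ} (A : Matrix (Fin l) (Fin k) ℤ) (n : ℕ) :
    (solTuples A n).card ≤ n ^ (k - rankR A) := by
  have h := card_filter_solTuples_le A n ∅ ∅ (Nat.zero_le k)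
  have hrank : rankCols A Finset.univ = rankR A := by
    rw [rankCols_eq_finrank, rankR_eq_finrank, Finset.coe_univ, Set.image_univ]
  simpa [hrank] using h

theorem binomWeight_nonneg {α : Type*} (Γ S : Finset α) {q : ℝ} (h0 : 0 ≤ q) (h1 : q ≤ 1) :
    0 ≤ binomWeight Γ q S :=
  mul_nonneg (pow_nonneg h0 _) (pow_nonneg (sub_nonneg.2 h1) _)

/-- The probability that the binomial random subset contains a given set. -/
theorem sum_binomWeight_of_subset {α : Type*} [DecidableEq α] {Γ R : Finset α} (hR : R ⊆ Γ)
    (q : ℝ) :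
    ∑ S ∈ Γ.powerset, binomWeight Γ q S * (if R ⊆ S then 1 else 0) = q ^ R.card := by
  have h := Finset.prod_add (fun _ : α => q) (fun v => if v ∈ R then 0 else 1 - q) Γ
  have hleft : ∏ v ∈ Γ, (q + if v ∈ R then 0 else 1 - q) = q ^ R.card := by
    rw [← Finset.prod_sdiff hR, Finset.prod_eq_one, one_mul]
    · exact Finset.prod_eq_pow_card fun v hv => by simp [hv]
    · intro v hv
      simp [(Finset.mem_sdiff.1 hv).2]
  rw [← hleft, h]
  refine Finset.sum_congr rfl fun S hS => ?_
  rw [Finset.prod_const, binomWeight]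
  by_cases hRS : R ⊆ S
  · rw [if_pos hRS, mul_one, ← Finset.card_sdiff_of_subset (Finset.mem_powerset.1 hS)]
    congr 1
    refine (Finset.prod_eq_pow_card fun v hv => ?_).symm
    rw [if_neg fun hvR => (Finset.mem_sdiff.1 hv).2 (hRS hvR)]
  · obtain ⟨v, hvR, hvS⟩ := Finset.not_subset.1 hRS
    have hzero : ∏ w ∈ Γ \ S, (if w ∈ R then 0 else 1 - q) = 0 :=
      Finset.prod_eq_zero (Finset.mem_sdiff.2 ⟨hR hvR, hvS⟩) (if_pos hvR)
    rw [if_neg hRS, mul_zero, hzero, mul_zero]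

/-- Pairs of a column index `j` and an `i`-set of column indices avoiding `j`. -/
def rootedSets (k i : ℕ) : Finset (Fin k × Finset (Fin k)) :=
  (Finset.univ ×ˢ Finset.powersetCard i Finset.univ).filter fun p => p.1 ∉ p.2

theorem mem_rootedSets {k i : ℕ} {p : Fin k × Finset (Fin k)} :
    p ∈ rootedSets k i ↔ p.2.card = i ∧ p.1 ∉ p.2 := by
  simp [rootedSets, Finset.mem_powersetCard]

theorem card_rootedSets_le (k i : ℕ) : (rootedSets k i).card ≤ k * 2 ^ k := by
  calc _ ≤ (Finset.univ : Finset (Fin k × Finset (Fin k))).card :=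
        Finset.card_le_card (Finset.subset_univ _)
    _ = _ := by simp

theorem degi_solEdges_le {l k : ℕ} (A : Matrix (Fin l) (Fin k) ℤ) (n i v : ℕ) (S : Finset ℕ) :
    degi (solEdges A n) i v S ≤ ((solTuples A n ×ˢ rootedSets k i).filter
      fun t => t.1 t.2.1 = v ∧ t.2.2.image t.1 ⊆ S).card := by
  classical
  refine (Finset.card_le_card ?_).trans (Finset.card_image_le (f := fun t => Finset.univ.image t.1))
  intro e he
  obtain ⟨heE, hve, hi⟩ := Finset.mem_filter.1 he
  obtain ⟨x, hx, rfl⟩ := mem_solEdges.1 heE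
  obtain ⟨j, -, rfl⟩ := Finset.mem_image.1 hve
  obtain ⟨T, hT, hTi⟩ := Finset.exists_subset_card_eq hi
  have hxinj := (mem_solTuples.1 hx).2.1
  set I : Finset (Fin k) := Finset.univ.filter fun a => x a ∈ T with hI
  have hIT : I.image x = T := by
    ext y
    simp only [hI, Finset.mem_image, Finset.mem_filter, Finset.mem_univ, true_and]
    constructor
    · rintro ⟨a, ha, rfl⟩
      exact ha
    · intro hy
      obtain ⟨a, -, rfl⟩ := Finset.mem_image.1 (Finset.mem_inter.1 (hT hy)).1
      exact ⟨a, hy, rfl⟩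
  refine Finset.mem_image.2 ⟨(x, j, I), Finset.mem_filter.2 ⟨Finset.mem_product.2
    ⟨hx, mem_rootedSets.2 ⟨?_, ?_⟩⟩, rfl, ?_⟩, rfl⟩
  · rw [← hTi, ← hIT, Finset.card_image_of_injective _ hxinj]
  · intro hj
    have hjT : x j ∈ T := (Finset.mem_filter.1 hj).2
    exact absurd rfl (Finset.mem_erase.1 (Finset.mem_inter.1 (hT hjT)).2).1
  · show I.image x ⊆ S
    rw [hIT]
    exact fun y hy => Finset.mem_of_mem_erase (Finset.mem_inter.1 (hT hy)).2

theorem mu_solEdges_le {l k : ℕ} (A : Matrix (Fin l) (Fin k) ℤ) (n i : ℕ) {q : ℝ}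
    (h0 : 0 ≤ q) (h1 : q ≤ 1) :
    mu (Finset.Icc 1 n) (solEdges A n) i q ≤
      ∑ t ∈ solTuples A n ×ˢ rootedSets k i, ∑ t' ∈ solTuples A n ×ˢ rootedSets k i,
        if t.1 t.2.1 = t'.1 t'.2.1 then q ^ (t.2.2.image t.1 ∪ t'.2.2.image t'.1).card else 0 := by
  classical
  set V := Finset.Icc 1 n with hV
  set P := solTuples A n ×ˢ rootedSets k i with hP
  have hsub : ∀ t ∈ P, t.2.2.image t.1 ⊆ V := by
    intro t ht y hy
    obtain ⟨a, -, rfl⟩ := Finset.mem_image.1 hy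
    exact Finset.mem_Icc.2 ((mem_solTuples.1 (Finset.mem_product.1 ht).1).1 a)
  have hdeg : ∀ S : Finset ℕ, ∑ v ∈ V, (degi (solEdges A n) i v S : ℝ) ^ 2 ≤
      ∑ t ∈ P, ∑ t' ∈ P, if t.1 t.2.1 = t'.1 t'.2.1 then
        (if t.2.2.image t.1 ∪ t'.2.2.image t'.1 ⊆ S then (1 : ℝ) else 0) else 0 := by
    intro S
    calc _ ≤ ∑ v ∈ V, ∑ t ∈ P, ∑ t' ∈ P,
          (if t.1 t.2.1 = v ∧ t.2.2.image t.1 ⊆ S then (1 : ℝ) else 0) *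
            (if t'.1 t'.2.1 = v ∧ t'.2.2.image t'.1 ⊆ S then (1 : ℝ) else 0) := by
          refine Finset.sum_le_sum fun v _ => ?_
          rw [← Finset.sum_mul_sum, ← sq]
          refine pow_le_pow_left₀ (Nat.cast_nonneg _) ?_ 2
          rw [Finset.sum_boole]
          exact_mod_cast degi_solEdges_le A n i v S
      _ = ∑ t ∈ P, ∑ t' ∈ P, ∑ v ∈ V,
          (if t.1 t.2.1 = v ∧ t.2.2.image t.1 ⊆ S then (1 : ℝ) else 0) *
            (if t'.1 t'.2.1 = v ∧ t'.2.2.image t'.1 ⊆ S then (1 : ℝ) else 0) := by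
          rw [Finset.sum_comm]
          exact Finset.sum_congr rfl fun t _ => Finset.sum_comm
      _ ≤ _ := by
          refine Finset.sum_le_sum fun t _ => Finset.sum_le_sum fun t' _ => ?_
          calc _ ≤ ∑ v ∈ V, if t.1 t.2.1 = v then (if t.1 t.2.1 = t'.1 t'.2.1 then
                (if t.2.2.image t.1 ∪ t'.2.2.image t'.1 ⊆ S then (1 : ℝ) else 0) else 0)
                  else 0 := by
                refine Finset.sum_le_sum fun v _ => ?_
                simp only [Finset.union_subset_iff]
                split_ifs <;> simp_all
            _ ≤ _ := by
                rw [Finset.sum_ite_eq]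
                split_ifs <;> simp
  calc _ ≤ ∑ S ∈ V.powerset, binomWeight V q S * ∑ t ∈ P, ∑ t' ∈ P,
        if t.1 t.2.1 = t'.1 t'.2.1 then
          (if t.2.2.image t.1 ∪ t'.2.2.image t'.1 ⊆ S then (1 : ℝ) else 0) else 0 :=
        Finset.sum_le_sum fun S _ =>
          mul_le_mul_of_nonneg_left (hdeg S) (binomWeight_nonneg V S h0 h1)
    _ = ∑ t ∈ P, ∑ t' ∈ P, ∑ S ∈ V.powerset, binomWeight V q S *
        (if t.1 t.2.1 = t'.1 t'.2.1 then
          (if t.2.2.image t.1 ∪ t'.2.2.image t'.1 ⊆ S then (1 : ℝ) else 0) else 0) := by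
        simp only [Finset.mul_sum]
        rw [Finset.sum_comm]
        exact Finset.sum_congr rfl fun t _ => Finset.sum_comm
    _ = _ := by
        refine Finset.sum_congr rfl fun t ht => Finset.sum_congr rfl fun t' ht' => ?_
        split_ifs with h
        · exact sum_binomWeight_of_subset (Finset.union_subset (hsub t ht) (hsub t' ht')) q
        · simp

theorem sum_solTuples_le {l k : ℕ} (A : Matrix (Fin l) (Fin k) ℤ) (n : ℕ) {i : ℕ} {q : ℝ}
    (h0 : 0 ≤ q) (hrank : rankR A = l)
    (hrk : ∀ W : Finset (Fin k), W.Nonempty → rankR A + 1 ≤ rankCols A Wᶜ + W.card)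
    (hq : ∀ W : Finset (Fin k), W.Nonempty →
      1 ≤ q ^ (W.card - 1) * (n : ℝ) ^ (rankCols A Wᶜ + W.card - (l + 1)))
    {x : Fin k → ℕ} {I : Finset (Fin k)} (hx : Function.Injective x) (hI : I.card = i)
    {p : Fin k × Finset (Fin k)} (hp : p ∈ rootedSets k i) (j : Fin k) :
    ∑ y ∈ solTuples A n,
      (if x j = y p.1 then q ^ (I.image x ∪ p.2.image y).card else 0) ≤
      2 ^ k * ((k : ℝ) ^ k * (q ^ (2 * i) * (n : ℝ) ^ (k - l - 1))) := by
  classical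
  obtain ⟨j', J⟩ := p
  obtain ⟨hJ, hj'⟩ := mem_rootedSets.1 hp
  simp only at hJ hj' ⊢
  set 𝒲 := (insert j' J).powerset.filter fun W => j' ∈ W with h𝒲
  set F : Finset (Fin k) → Finset (Fin k → ℕ) := fun W =>
    (solTuples A n).filter fun y => ∀ a ∈ W, y a ∈ Finset.univ.image x with hF
  have hpoint : ∀ y ∈ solTuples A n,
      (if x j = y j' then q ^ (I.image x ∪ J.image y).card else 0) ≤
        ∑ W ∈ 𝒲, if y ∈ F W then q ^ (2 * i - (W.card - 1)) else 0 := by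
    intro y hy
    have hnonneg : ∀ W ∈ 𝒲, 0 ≤ if y ∈ F W then q ^ (2 * i - (W.card - 1)) else 0 := by
      intro W _
      split_ifs
      · exact pow_nonneg h0 _
      · exact le_rfl
    split_ifs with hxy
    · set J₀ := J.filter fun a => y a ∈ I.image x with hJ₀
      have hj'J₀ : j' ∉ J₀ := fun h => hj' (Finset.mem_filter.1 h).1
      have hyinj := (mem_solTuples.1 hy).2.1
      have hinter : I.image x ∩ J.image y = J₀.image y := by
        ext z
        simp only [Finset.mem_inter, hJ₀, Finset.mem_image, Finset.mem_filter]
        constructor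
        · rintro ⟨hz, a, ha, rfl⟩
          exact ⟨a, ⟨ha, hz⟩, rfl⟩
        · rintro ⟨a, ⟨ha, hz⟩, rfl⟩
          exact ⟨hz, a, ha, rfl⟩
      have hcard : (I.image x ∪ J.image y).card = 2 * i - ((insert j' J₀).card - 1) := by
        have h := Finset.card_union_add_card_inter (I.image x) (J.image y)
        rw [hinter, Finset.card_image_of_injective _ hyinj, Finset.card_image_of_injective _ hyinj,
          Finset.card_image_of_injective _ hx, hI, hJ] at h
        rw [Finset.card_insert_of_notMem hj'J₀]
        omega
      have hmem : insert j' J₀ ∈ 𝒲 := Finset.mem_filter.2 ⟨Finset.mem_powerset.2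
        (Finset.insert_subset_insert _ (Finset.filter_subset _ _)), Finset.mem_insert_self _ _⟩
      have hyF : y ∈ F (insert j' J₀) := by
        refine Finset.mem_filter.2 ⟨hy, fun a ha => ?_⟩
        rcases Finset.mem_insert.1 ha with rfl | ha
        · exact hxy ▸ Finset.mem_image_of_mem x (Finset.mem_univ j)
        · exact Finset.image_subset_image (Finset.subset_univ I) (Finset.mem_filter.1 ha).2
      refine le_trans (le_of_eq ?_) (Finset.single_le_sum hnonneg hmem)
      rw [if_pos hyF, hcard]
    · exact Finset.sum_nonneg hnonneg
  have hW : ∀ W ∈ 𝒲, ∑ y ∈ solTuples A n, (if y ∈ F W then q ^ (2 * i - (W.card - 1)) else 0) ≤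
      (k : ℝ) ^ k * (q ^ (2 * i) * (n : ℝ) ^ (k - l - 1)) := by
    intro W hW
    obtain ⟨hWsub, hjW⟩ := Finset.mem_filter.1 hW
    have hne : W.Nonempty := ⟨j', hjW⟩
    have hpos := hne.card_pos
    have hWi : W.card ≤ i + 1 := by
      have := Finset.card_le_card (Finset.mem_powerset.1 hWsub)
      rwa [Finset.card_insert_of_notMem hj', hJ] at this
    have hFcard : ((F W).card : ℝ) ≤ (k : ℝ) ^ k * (n : ℝ) ^ (Wᶜ.card - rankCols A Wᶜ) := by
      have h := card_filter_solTuples_le A n W (Finset.univ.image x)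
        (Finset.card_image_le.trans (by simp))
      have hk : k ^ W.card ≤ k ^ k :=
        Nat.pow_le_pow_right j'.pos (by simpa using Finset.card_le_univ W)
      exact_mod_cast h.trans (Nat.mul_le_mul_right _ hk)
    rw [← Finset.sum_filter, Finset.sum_const, nsmul_eq_mul,
      Finset.filter_mem_eq_inter, Finset.inter_eq_right.2 (Finset.filter_subset _ _)]
    have hcompl : Wᶜ.card + W.card = k := by
      rw [Finset.card_compl_add_card, Fintype.card_fin]
    have hexp : Wᶜ.card - rankCols A Wᶜ + (rankCols A Wᶜ + W.card - (l + 1)) = k - l - 1 := by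
      have h2 := rankCols_le_card A Wᶜ
      have h3 := hrk W hne
      omega
    calc ((F W).card : ℝ) * q ^ (2 * i - (W.card - 1))
        ≤ (k : ℝ) ^ k * (n : ℝ) ^ (Wᶜ.card - rankCols A Wᶜ) * q ^ (2 * i - (W.card - 1)) :=
          mul_le_mul_of_nonneg_right hFcard (pow_nonneg h0 _)
      _ ≤ (k : ℝ) ^ k * (n : ℝ) ^ (Wᶜ.card - rankCols A Wᶜ) * q ^ (2 * i - (W.card - 1)) *
          (q ^ (W.card - 1) * (n : ℝ) ^ (rankCols A Wᶜ + W.card - (l + 1))) :=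
          le_mul_of_one_le_right (by positivity) (hq W hne)
      _ = (k : ℝ) ^ k * ((q ^ (2 * i - (W.card - 1)) * q ^ (W.card - 1)) *
          ((n : ℝ) ^ (Wᶜ.card - rankCols A Wᶜ) *
            (n : ℝ) ^ (rankCols A Wᶜ + W.card - (l + 1)))) := by ring
      _ = _ := by
          rw [← pow_add, ← pow_add, hexp, Nat.sub_add_cancel (by omega)]
  have h𝒲card : (𝒲.card : ℝ) ≤ 2 ^ k := by
    have h : 𝒲.card ≤ 2 ^ k := (Finset.card_le_univ 𝒲).trans (by simp)
    exact_mod_cast h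
  calc _ ≤ ∑ y ∈ solTuples A n, ∑ W ∈ 𝒲, if y ∈ F W then q ^ (2 * i - (W.card - 1)) else 0 :=
        Finset.sum_le_sum hpoint
    _ = ∑ W ∈ 𝒲, ∑ y ∈ solTuples A n, if y ∈ F W then q ^ (2 * i - (W.card - 1)) else 0 :=
        Finset.sum_comm
    _ ≤ ∑ W ∈ 𝒲, (k : ℝ) ^ k * (q ^ (2 * i) * (n : ℝ) ^ (k - l - 1)) := Finset.sum_le_sum hW
    _ = 𝒲.card * ((k : ℝ) ^ k * (q ^ (2 * i) * (n : ℝ) ^ (k - l - 1))) := by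
        rw [Finset.sum_const, nsmul_eq_mul]
    _ ≤ _ := mul_le_mul_of_nonneg_right h𝒲card (by positivity)

theorem one_le_pow_mul_pow_of_rpow_le {l k : ℕ} {A : Matrix (Fin l) (Fin k) ℤ}
    (hone : A.mulVec 1 = 0) (hirr : Irredundant A) (hrank : rankR A = l) {n : ℕ} (hn : 1 ≤ n)
    {q : ℝ} (hq : (n : ℝ) ^ (-(1 : ℝ) / mOfMatrix A) ≤ q) {W : Finset (Fin k)}
    (hW : W.Nonempty) :
    1 ≤ q ^ (W.card - 1) * (n : ℝ) ^ (rankCols A Wᶜ + W.card - (l + 1)) := by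
  have hn1 : (1 : ℝ) ≤ n := by exact_mod_cast hn
  have hn0 : (0 : ℝ) < n := by linarith
  have hpos := hW.card_pos
  rcases Nat.lt_or_ge W.card 2 with hlt | hge
  · rw [show W.card - 1 = 0 by omega, pow_zero, one_mul]
    exact one_le_pow₀ hn1
  have hrk := rankR_add_two_le hone hirr hge
  rw [hrank] at hrk
  set D := rankCols A Wᶜ + W.card - (l + 1) with hD
  set m := mOfMatrix A with hm
  have hD1 : 1 ≤ D := by omega
  have hDpos : (0 : ℝ) < D := by exact_mod_cast hD1
  have hw : ((W.card - 1 : ℕ) : ℝ) = (W.card : ℝ) - 1 := by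
    rw [Nat.cast_sub hpos, Nat.cast_one]
  have hDcast : (W.card : ℝ) - 1 + (rankCols A Wᶜ : ℝ) - (rankR A : ℝ) = D := by
    rw [hD, hrank, Nat.cast_sub (by omega)]
    push_cast
    ring
  have hbdd : BddAbove { r : ℝ | ∃ W : Finset (Fin k), 2 ≤ W.card ∧
      r = ((W.card : ℝ) - 1) / (((W.card : ℝ) - 1) + (rankCols A Wᶜ : ℝ) - (rankR A : ℝ)) } := by
    refine Set.Finite.bddAbove ((Set.finite_range fun W : Finset (Fin k) =>
      ((W.card : ℝ) - 1) / (((W.card : ℝ) - 1) + (rankCols A Wᶜ : ℝ) - (rankR A : ℝ))).subset ?_)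
    rintro r ⟨W', -, rfl⟩
    exact ⟨W', rfl⟩
  have hle : ((W.card - 1 : ℕ) : ℝ) / D ≤ m := by
    rw [hw, ← hDcast]
    exact le_csSup hbdd ⟨W, hge, rfl⟩
  have hwpos : (0 : ℝ) < ((W.card - 1 : ℕ) : ℝ) := by
    exact_mod_cast (by omega : 0 < W.card - 1)
  have hmpos : 0 < m := (div_pos hwpos hDpos).trans_le hle
  have hexp : 0 ≤ -(1 : ℝ) / m * ((W.card - 1 : ℕ) : ℝ) + D := by
    have h : ((W.card - 1 : ℕ) : ℝ) / m ≤ D := by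
      rw [div_le_iff₀ hmpos]
      rw [div_le_iff₀ hDpos] at hle
      linarith
    have h2 : -(1 : ℝ) / m * ((W.card - 1 : ℕ) : ℝ) = -(((W.card - 1 : ℕ) : ℝ) / m) := by ring
    linarith
  calc (1 : ℝ) ≤ (n : ℝ) ^ (-(1 : ℝ) / m * ((W.card - 1 : ℕ) : ℝ) + D) :=
        Real.one_le_rpow hn1 hexp
    _ = ((n : ℝ) ^ (-(1 : ℝ) / m)) ^ (W.card - 1) * (n : ℝ) ^ D := by
        rw [Real.rpow_add hn0, Real.rpow_mul hn0.le, Real.rpow_natCast, Real.rpow_natCast]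
    _ ≤ _ := by
        gcongr

theorem exists_mu_solEdges_le {l k : ℕ} (A : Matrix (Fin l) (Fin k) ℤ)
    (hirr : Irredundant A) (hdr : DensityRegular A) (hrank : rankR A = l) :
    ∃ K : ℝ, 1 ≤ K ∧ ∃ n₀ : ℕ, ∀ i : ℕ, 1 ≤ i → i ≤ k - 1 → ∀ n ≥ n₀, ∀ q : ℝ,
      (n : ℝ) ^ (-(1 : ℝ) / mOfMatrix A) ≤ q → q ≤ 1 →
      mu (Finset.Icc 1 n) (solEdges A n) i q ≤
        K * q ^ (2 * i) * ((solEdges A n).card : ℝ) ^ 2 / (n : ℝ) := by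
  have hone := hdr.mulVec_one_eq_zero
  have hlk : l ≤ k := by
    rw [← hrank, rankR]
    simpa using Matrix.rank_le_width (A.map fun a => (a : ℝ))
  obtain ⟨c, hc, n₁, hn₁⟩ := exists_le_card_solEdges hdr hlk
  set C : ℝ := (k * 2 ^ k) ^ 2 * (2 ^ k * (k : ℝ) ^ k) with hC
  refine ⟨max 1 (C / c ^ 2), le_max_left _ _, max 1 n₁, fun i hi hik n hn q hq hq1 => ?_⟩
  have hn1 : 1 ≤ n := (le_max_left _ _).trans hn
  have hnpos : (0 : ℝ) < n := by exact_mod_cast hn1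
  have hE := hn₁ n ((le_max_right _ _).trans hn)
  have hq0 : 0 ≤ q := (Real.rpow_nonneg hnpos.le _).trans hq
  have hlk' : l + 1 ≤ k := by
    have h1 := rankR_add_two_le hone hirr (W := Finset.univ) (by simp; omega)
    have h2 := rankCols_le_card A (Finset.univ : Finset (Fin k))ᶜ
    simp only [Finset.compl_univ, Finset.card_empty, Finset.card_univ, Fintype.card_fin] at h1 h2
    omega
  set Q : ℝ := 2 ^ k * ((k : ℝ) ^ k * (q ^ (2 * i) * (n : ℝ) ^ (k - l - 1))) with hQ
  have hQ0 : 0 ≤ Q := by positivity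
  have hroot : ((rootedSets k i).card : ℝ) ≤ k * 2 ^ k := by
    exact_mod_cast card_rootedSets_le k i
  have hsol : ((solTuples A n).card : ℝ) ≤ (n : ℝ) ^ (k - l) := by
    have := card_solTuples_le_pow A n
    rw [hrank] at this
    exact_mod_cast this
  have hmu : mu (Finset.Icc 1 n) (solEdges A n) i q ≤
      C * q ^ (2 * i) * ((n : ℝ) ^ (k - l)) ^ 2 / n := by
    calc _ ≤ ∑ t ∈ solTuples A n ×ˢ rootedSets k i, (rootedSets k i).card * Q := by
          refine (mu_solEdges_le A n i hq0 hq1).trans (Finset.sum_le_sum fun t ht => ?_)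
          obtain ⟨htx, htp⟩ := Finset.mem_product.1 ht
          rw [Finset.sum_product_right, ← nsmul_eq_mul, ← Finset.sum_const]
          exact Finset.sum_le_sum fun p hp => sum_solTuples_le A n hq0 hrank
            (fun W hW => rankR_add_one_le hone hW)
            (fun W hW => one_le_pow_mul_pow_of_rpow_le hone hirr hrank hn1 hq hW)
            (mem_solTuples.1 htx).2.1 (mem_rootedSets.1 htp).1 hp t.2.1
      _ = ((solTuples A n).card * (rootedSets k i).card) * ((rootedSets k i).card * Q) := by
          rw [Finset.sum_const, nsmul_eq_mul, Finset.card_product, Nat.cast_mul]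
      _ ≤ ((n : ℝ) ^ (k - l) * (k * 2 ^ k)) * ((k * 2 ^ k) * Q) := by gcongr
      _ = _ := by
          rw [hQ, hC, show k - l = k - l - 1 + 1 by omega, Nat.add_sub_cancel, pow_succ]
          field_simp
  calc _ ≤ C * q ^ (2 * i) * ((n : ℝ) ^ (k - l)) ^ 2 / n := hmu
    _ = C / c ^ 2 * q ^ (2 * i) * (c * (n : ℝ) ^ (k - l)) ^ 2 / n := by
        field_simp
    _ ≤ _ := by
        gcongr
        exact le_max_right _ _

/-- The hypergraph of distinct-valued solutions of a density regular system is
`(K, (n^{-1/m(A)}))`-bounded. -/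
theorem solution_hypergraph_bounded {l k : ℕ} (A : Matrix (Fin l) (Fin k) ℤ)
    (hirr : Irredundant A) (hdr : DensityRegular A) (hrank : rankR A = l) :
    (∀ i : ℕ, 1 ≤ i → i ≤ k - 1 → ∃ K : ℝ, ∃ n₀ : ℕ, ∀ n ≥ n₀, ∀ q : ℝ,
      (n : ℝ) ^ (-(1 : ℝ) / mOfMatrix A) ≤ q → q ≤ 1 →
      mu (Finset.Icc 1 n) (solEdges A n) i q ≤
        K * q ^ (2 * i) * ((solEdges A n).card : ℝ) ^ 2 / (n : ℝ)) ∧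
    ∃ K : ℝ, 1 ≤ K ∧ KPBounded k (fun n => Finset.Icc 1 n) (fun n => solEdges A n) K
      (fun n => (n : ℝ) ^ (-(1 : ℝ) / mOfMatrix A)) := by
  obtain ⟨K, hK, n₀, h⟩ := exists_mu_solEdges_le A hirr hdr hrank
  refine ⟨fun i hi hik => ⟨K, n₀, h i hi hik⟩, K, hK, fun i hi hik => ⟨n₀, fun n hn q hq hq1 => ?_⟩⟩
  simpa using h i hi hik n hn q hq hq1
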